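/- Let U be a unit vector field tangent to a conformal foliation of codimension 2 on a Riemannian 3-manifold (M,g) with dilation function λ (i.e., the leaf space projection is semi-conformal with dilation λ). Then for any smooth function f on M, the Lie derivative of g along fU satisfies L_{fU} g = −2f U(ln λ)(g − θ²) + 2 df ⊙ θ + 2f μ♭ ⊙ θ, where θ = g(U,·), μ is the mean curvature vector of the leaves, and ⊙ denotes the symmetric product of 1-forms. -/

import Mathlib

open scoped BigOperators

noncomputable section

/-- Partial derivative of `f` in the `i`-th coordinate direction. -/
def pd {n : ℕ} (f : (Fin n → ℝ) → ℝ) (i : Fin n) (x : Fin n → ℝ) : ℝ :=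
  fderiv ℝ f x (Pi.single i 1)

/-- Pointwise inverse of a metric (the components `g^{ij}`). -/
def ginv {n : ℕ} (g : (Fin n → ℝ) → Matrix (Fin n) (Fin n) ℝ) (x : Fin n → ℝ) :
    Matrix (Fin n) (Fin n) ℝ := (g x)⁻¹

/-- A smooth Riemannian metric in coordinates. -/
def IsMetric {n : ℕ} (g : (Fin n → ℝ) → Matrix (Fin n) (Fin n) ℝ) : Prop :=
  (∀ i j, ContDiff ℝ (⊤ : ℕ∞) fun x => g x i j) ∧ ∀ x, (g x).IsSymm ∧ (g x).PosDef

/-- A smooth vector field (or componentwise-smooth family). -/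
def SmoothVF {n : ℕ} (X : (Fin n → ℝ) → Fin n → ℝ) : Prop :=
  ∀ k, ContDiff ℝ (⊤ : ℕ∞) fun x => X x k

/-- Christoffel symbols `Γ^k_{ij}` of the metric `g`. -/
def christoffel {n : ℕ} (g : (Fin n → ℝ) → Matrix (Fin n) (Fin n) ℝ)
    (k i j : Fin n) (x : Fin n → ℝ) : ℝ :=
  (1 / 2) * ∑ l, ginv g x k l *
    (pd (fun y => g y l j) i x + pd (fun y => g y l i) j x - pd (fun y => g y i j) l x)

/-- Covariant derivative `(∇_X Y)^k` of the Levi-Civita connection of `g`. -/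
def covD {n : ℕ} (g : (Fin n → ℝ) → Matrix (Fin n) (Fin n) ℝ)
    (X Y : (Fin n → ℝ) → Fin n → ℝ) (x : Fin n → ℝ) (k : Fin n) : ℝ :=
  (∑ i, X x i * pd (fun y => Y y k) i x) + ∑ i, ∑ j, christoffel g k i j x * X x i * Y x j

/-- The Lie bracket of vector fields, `[X,Y]^k = X^i ∂_i Y^k - Y^i ∂_i X^k`. -/
def bracket {n : ℕ} (X Y : (Fin n → ℝ) → Fin n → ℝ) (x : Fin n → ℝ) (k : Fin n) : ℝ :=
  ∑ i, (X x i * pd (fun y => Y y k) i x - Y x i * pd (fun y => X y k) i x)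

/-- `φ : (M³,g) → (N²,h)` is semi-conformal with dilation `λ`, in the local-coordinate
characterization `g^{ij} φ^α_i φ^β_j = λ² h^{αβ}`. -/
def SemiConformal (g : (Fin 3 → ℝ) → Matrix (Fin 3) (Fin 3) ℝ)
    (h : (Fin 2 → ℝ) → Matrix (Fin 2) (Fin 2) ℝ)
    (φ : (Fin 3 → ℝ) → Fin 2 → ℝ) (lam : (Fin 3 → ℝ) → ℝ) : Prop :=
  ∀ x α β, (∑ i, ∑ j, ginv g x i j * pd (fun y => φ y α) i x * pd (fun y => φ y β) j x)
    = lam x ^ 2 * ginv h (φ x) α β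

/-- A vector field is vertical when it lies in `ker dφ`. -/
def Vertical (φ : (Fin 3 → ℝ) → Fin 2 → ℝ) (U : (Fin 3 → ℝ) → Fin 3 → ℝ) : Prop :=
  ∀ x α, (∑ i, pd (fun y => φ y α) i x * U x i) = 0

/-- A vector field of unit length for `g`. -/
def UnitField (g : (Fin 3 → ℝ) → Matrix (Fin 3) (Fin 3) ℝ)
    (U : (Fin 3 → ℝ) → Fin 3 → ℝ) : Prop :=
  ∀ x, (∑ i, ∑ j, g x i j * U x i * U x j) = 1

/-- The dual 1-form `X♭ = g(X,·)`. -/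
def flat (g : (Fin 3 → ℝ) → Matrix (Fin 3) (Fin 3) ℝ)
    (X : (Fin 3 → ℝ) → Fin 3 → ℝ) (j : Fin 3) (x : Fin 3 → ℝ) : ℝ :=
  ∑ k, g x j k * X x k

/-- Horizontal projection (relative to the unit vertical field `U`):
`H X = X - g(X,U) U`. -/
def Hproj (g : (Fin 3 → ℝ) → Matrix (Fin 3) (Fin 3) ℝ)
    (U X : (Fin 3 → ℝ) → Fin 3 → ℝ) (x : Fin 3 → ℝ) (k : Fin 3) : ℝ :=
  X x k - (∑ i, ∑ j, g x i j * X x i * U x j) * U x k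

/-- The mean curvature vector `μ = ∇_U U` of the fibres (`U` the unit vertical field). -/
def meanCurv (g : (Fin 3 → ℝ) → Matrix (Fin 3) (Fin 3) ℝ)
    (U : (Fin 3 → ℝ) → Fin 3 → ℝ) (x : Fin 3 → ℝ) (k : Fin 3) : ℝ :=
  covD g U U x k

/-- Lie derivative of the metric: `(L_E g)_{ij} = E^k ∂_k g_{ij} + g_{kj} ∂_i E^k + g_{ik} ∂_j E^k`. -/
def lieD {n : ℕ} (g : (Fin n → ℝ) → Matrix (Fin n) (Fin n) ℝ)
    (E : (Fin n → ℝ) → Fin n → ℝ) (i j : Fin n) (x : Fin n → ℝ) : ℝ :=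
  (∑ k, E x k * pd (fun y => g y i j) k x)
    + (∑ k, g x k j * pd (fun y => E y k) i x)
    + ∑ k, g x i k * pd (fun y => E y k) j x

section PartialDerivatives

variable {n : ℕ} {a b : (Fin n → ℝ) → ℝ} {x : Fin n → ℝ}

theorem pd_add (ha : DifferentiableAt ℝ a x) (hb : DifferentiableAt ℝ b x) (i : Fin n) :
    pd (fun y => a y + b y) i x = pd a i x + pd b i x := by
  simp [pd, fderiv_fun_add ha hb]

theorem pd_mul (ha : DifferentiableAt ℝ a x) (hb : DifferentiableAt ℝ b x) (i : Fin n) :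
    pd (fun y => a y * b y) i x = pd a i x * b x + a x * pd b i x := by
  simp [pd, fderiv_fun_mul ha hb]
  ring

theorem pd_sum {ι : Type*} {s : Finset ι} {F : ι → (Fin n → ℝ) → ℝ}
    (hF : ∀ k ∈ s, DifferentiableAt ℝ (F k) x) (i : Fin n) :
    pd (fun y => ∑ k ∈ s, F k y) i x = ∑ k ∈ s, pd (F k) i x := by
  simp [pd, fderiv_fun_sum hF]

theorem pd_const (c : ℝ) (i : Fin n) : pd (fun _ => c) i x = 0 := by
  simp [pd]

theorem contDiff_pd (ha : ContDiff ℝ (⊤ : ℕ∞) a) (i : Fin n) :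
    ContDiff ℝ (⊤ : ℕ∞) (pd a i) :=
  (ha.fderiv_right (by simp)).clm_apply contDiff_const

theorem pd_comm (ha : ContDiff ℝ (⊤ : ℕ∞) a) (i j : Fin n) :
    pd (pd a i) j x = pd (pd a j) i x := by
  have hd : DifferentiableAt ℝ (fderiv ℝ a) x :=
    ((ha.fderiv_right (m := (⊤ : ℕ∞)) (by simp)).differentiable (by simp)).differentiableAt
  have key : ∀ i j : Fin n, pd (pd a i) j x
      = fderiv ℝ (fderiv ℝ a) x (Pi.single j 1) (Pi.single i 1) := fun i j => by
    unfold pd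
    rw [fderiv_clm_apply hd (differentiableAt_const _)]
    simp
  rw [key, key]
  exact (ha.contDiffAt.isSymmSndFDerivAt
    (by simpa using WithTop.coe_le_coe.2 (le_top (a := (2 : ℕ∞))))).eq _ _

theorem fderiv_apply_eq_sum_pd (v : Fin n → ℝ) :
    fderiv ℝ a x v = ∑ i, v i * pd a i x := by
  conv_lhs => rw [pi_eq_sum_univ' v]
  simp [pd]

theorem pd_comp {m : ℕ} {p : (Fin m → ℝ) → ℝ} {ψ : (Fin n → ℝ) → Fin m → ℝ}
    (hp : DifferentiableAt ℝ p (ψ x)) (hψ : ∀ γ, DifferentiableAt ℝ (fun y => ψ y γ) x)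
    (i : Fin n) :
    pd (fun y => p (ψ y)) i x = ∑ γ, pd (fun y => ψ y γ) i x * pd p γ (ψ x) := by
  have hψ' : DifferentiableAt ℝ ψ x := differentiableAt_pi.2 hψ
  have hcomp := fderiv_comp x hp hψ'
  simp only [Function.comp_def] at hcomp
  rw [pd, hcomp, ContinuousLinearMap.comp_apply, fderiv_apply_eq_sum_pd]
  refine Finset.sum_congr rfl fun γ _ => ?_
  rw [pd, pd, fderiv_apply hψ']
  rfl

theorem pd_log (ha : DifferentiableAt ℝ a x) (h0 : a x ≠ 0) (i : Fin n) :
    pd (fun y => Real.log (a y)) i x = (a x)⁻¹ * pd a i x := by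
  simp [pd, fderiv.log ha h0]

theorem pd_inv_sq (ha : DifferentiableAt ℝ a x) (h0 : a x ≠ 0) (i : Fin n) :
    pd (fun y => (a y ^ 2)⁻¹) i x = -2 * ((a x)⁻¹ * pd a i x) * (a x ^ 2)⁻¹ := by
  have hd := (hasDerivAt_inv (pow_ne_zero 2 h0)).comp_hasFDerivAt x (ha.hasFDerivAt.pow 2)
  rw [pd, show (fun y => (a y ^ 2)⁻¹) = Inv.inv ∘ fun y => a y ^ 2 from rfl, hd.fderiv, pd]
  simp
  field_simp

end PartialDerivatives

section LieDerivatives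

variable {n : ℕ} {E : (Fin n → ℝ) → Fin n → ℝ} {x : Fin n → ℝ}

/-- Lie derivative of a 1-form: `(L_E ω)_i = E^k ∂_k ω_i + ω_k ∂_i E^k`. -/
def lieForm (ω : Fin n → (Fin n → ℝ) → ℝ) (E : (Fin n → ℝ) → Fin n → ℝ)
    (i : Fin n) (x : Fin n → ℝ) : ℝ :=
  (∑ k, E x k * pd (ω i) k x) + ∑ k, ω k x * pd (fun y => E y k) i x

theorem lieD_add {S T : (Fin n → ℝ) → Matrix (Fin n) (Fin n) ℝ}
    (hS : ∀ i j, DifferentiableAt ℝ (fun y => S y i j) x)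
    (hT : ∀ i j, DifferentiableAt ℝ (fun y => T y i j) x) (i j : Fin n) :
    lieD (fun y => S y + T y) E i j x = lieD S E i j x + lieD T E i j x := by
  simp only [lieD, Matrix.add_apply, pd_add (hS i j) (hT i j), mul_add, add_mul,
    Finset.sum_add_distrib]
  ring

theorem lieD_sum {ι : Type*} {s : Finset ι} {T : ι → (Fin n → ℝ) → Matrix (Fin n) (Fin n) ℝ}
    (hT : ∀ a ∈ s, ∀ i j, DifferentiableAt ℝ (fun y => T a y i j) x) (i j : Fin n) :
    lieD (fun y => ∑ a ∈ s, T a y) E i j x = ∑ a ∈ s, lieD (T a) E i j x := by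
  simp only [lieD, Matrix.sum_apply, pd_sum (fun a ha => hT a ha i j), Finset.mul_sum,
    Finset.sum_mul, Finset.sum_add_distrib]
  congr 1
  · congr 1 <;> exact Finset.sum_comm
  · exact Finset.sum_comm

theorem lieD_smul {c : (Fin n → ℝ) → ℝ} {T : (Fin n → ℝ) → Matrix (Fin n) (Fin n) ℝ}
    (hc : DifferentiableAt ℝ c x)
    (hT : ∀ i j, DifferentiableAt ℝ (fun y => T y i j) x) (i j : Fin n) :
    lieD (fun y => c y • T y) E i j x
      = (∑ k, E x k * pd c k x) * T x i j + c x * lieD T E i j x := by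
  simp only [lieD, Matrix.smul_apply, smul_eq_mul, pd_mul hc (hT i j), mul_add,
    Finset.sum_add_distrib, Finset.mul_sum, Finset.sum_mul]
  simp only [mul_assoc, mul_left_comm, add_assoc]

theorem lieD_vecMulVec {ω η : Fin n → (Fin n → ℝ) → ℝ}
    (hω : ∀ i, DifferentiableAt ℝ (ω i) x) (hη : ∀ i, DifferentiableAt ℝ (η i) x)
    (i j : Fin n) :
    lieD (fun y => Matrix.vecMulVec (fun k => ω k y) (fun k => η k y)) E i j x
      = lieForm ω E i x * η j x + ω i x * lieForm η E j x := by
  have h := fun k => pd_mul (hω i) (hη j) k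
  simp only [lieD, lieForm, Matrix.vecMulVec_apply, h, mul_add, add_mul,
    Finset.sum_add_distrib, Finset.mul_sum, Finset.sum_mul]
  have h₁ : ∀ k, ω k x * η j x * pd (fun y => E y k) i x
      = ω k x * pd (fun y => E y k) i x * η j x := fun k => by ring
  have h₂ : ∀ k, ω i x * η k x * pd (fun y => E y k) j x
      = ω i x * (η k x * pd (fun y => E y k) j x) := fun k => by ring
  have h₃ : ∀ k, E x k * (pd (ω i) k x * η j x) = E x k * pd (ω i) k x * η j x :=
    fun k => by ring
  have h₄ : ∀ k, E x k * (ω i x * pd (η j) k x) = ω i x * (E x k * pd (η j) k x) :=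
    fun k => by ring
  simp only [h₁, h₂, h₃, h₄]
  ring

/-- Rescaling the field: `L_{fE} T = f L_E T + df ⊗ T(E,·) + T(·,E) ⊗ df`. -/
theorem lieD_smul_field {f : (Fin n → ℝ) → ℝ} {T : (Fin n → ℝ) → Matrix (Fin n) (Fin n) ℝ}
    (hf : DifferentiableAt ℝ f x) (hE : ∀ k, DifferentiableAt ℝ (fun y => E y k) x)
    (i j : Fin n) :
    lieD T (fun y k => f y * E y k) i j x
      = f x * lieD T E i j x + pd f i x * (∑ k, T x k j * E x k)
        + pd f j x * (∑ k, T x i k * E x k) := by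
  have h := fun k m => pd_mul hf (hE k) m
  simp only [lieD, h, mul_add, Finset.sum_add_distrib, Finset.mul_sum]
  simp only [mul_left_comm (T x _ _), mul_assoc]
  ring

/-- `L_E dψ = d(dψ(E))`. -/
theorem lieForm_pd {ψ : (Fin n → ℝ) → ℝ} (hψ : ContDiff ℝ (⊤ : ℕ∞) ψ)
    (hE : ∀ k, DifferentiableAt ℝ (fun y => E y k) x) (i : Fin n) :
    lieForm (pd ψ) E i x = pd (fun y => ∑ k, pd ψ k y * E y k) i x := by
  have hd : ∀ k, DifferentiableAt ℝ (pd ψ k) x := fun k =>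
    ((contDiff_pd hψ k).differentiable (by simp)).differentiableAt
  rw [pd_sum fun k _ => (hd k).fun_mul (hE k), lieForm, ← Finset.sum_add_distrib]
  refine Finset.sum_congr rfl fun k _ => ?_
  rw [pd_mul (hd k) (hE k), pd_comm hψ i k]
  ring

end LieDerivatives

open scoped Matrix in
theorem sum_mul_christoffel {n : ℕ} {g : (Fin n → ℝ) → Matrix (Fin n) (Fin n) ℝ}
    {x : Fin n → ℝ} (hdet : IsUnit (g x).det) (i a b : Fin n) :
    ∑ k, g x i k * christoffel g k a b x
      = (1 / 2) * (pd (fun y => g y i b) a x + pd (fun y => g y i a) b x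
          - pd (fun y => g y a b) i x) := by
  set v : Fin n → ℝ := fun l =>
    pd (fun y => g y l b) a x + pd (fun y => g y l a) b x - pd (fun y => g y a b) l x
  have h : g x *ᵥ ((g x)⁻¹ *ᵥ v) = v := by
    rw [Matrix.mulVec_mulVec, Matrix.mul_nonsing_inv _ hdet, Matrix.one_mulVec]
  have hi : ∑ k, g x i k * ∑ l, (g x)⁻¹ k l * v l = v i := congrFun h i
  calc ∑ k, g x i k * christoffel g k a b x
      = (1 / 2) * ∑ k, g x i k * ∑ l, (g x)⁻¹ k l * v l := by
        rw [Finset.mul_sum]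
        refine Finset.sum_congr rfl fun k _ => ?_
        simp only [christoffel, ginv, v]
        ring
    _ = _ := by rw [hi]

open scoped Matrix in
theorem eq_vecMulVec_add_of_mul_inv_mul_transpose {G : Matrix (Fin 3) (Fin 3) ℝ}
    {H : Matrix (Fin 2) (Fin 2) ℝ} {A : Matrix (Fin 2) (Fin 3) ℝ} {u : Fin 3 → ℝ} {c : ℝ}
    (hGsymm : G.IsSymm) (hG : IsUnit G.det) (hH : IsUnit H.det) (hc : c ≠ 0)
    (hA : A * G⁻¹ * Aᵀ = c • H⁻¹) (hAu : A *ᵥ u = 0) (hu : u ⬝ᵥ G *ᵥ u = 1) :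
    G = Matrix.vecMulVec (G *ᵥ u) (G *ᵥ u) + c⁻¹ • (Aᵀ * H * A) := by
  set R : Matrix Unit (Fin 3) ℝ := Matrix.replicateRow Unit (G *ᵥ u)
  set K : Matrix (Fin 3) Unit ℝ := Matrix.replicateCol Unit u
  have hAK : A * K = 0 := by
    ext i j
    exact congrFun hAu i
  have hRK : R * K = 1 := by
    ext i j
    simpa [R, K, Matrix.mul_apply, dotProduct, mul_comm] using hu
  have hRT : R = Kᵀ * G := by
    ext i j
    simp [R, K, Matrix.mul_apply, Matrix.mulVec, dotProduct, mul_comm, hGsymm.apply]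
  have hRA : R * (G⁻¹ * Aᵀ) = 0 := by
    rw [hRT, Matrix.mul_assoc, Matrix.mul_nonsing_inv_cancel_left _ _ hG, ← Matrix.transpose_mul,
      hAK, Matrix.transpose_zero]
  have hBC : Matrix.fromRows A R * Matrix.fromCols (c⁻¹ • (G⁻¹ * Aᵀ * H)) K = 1 := by
    rw [Matrix.fromRows_mul_fromCols, hAK, hRK, Matrix.mul_smul, Matrix.mul_smul,
      ← Matrix.mul_assoc R, hRA, ← Matrix.mul_assoc A, ← Matrix.mul_assoc A, hA,
      Matrix.smul_mul, Matrix.nonsing_inv_mul _ hH, smul_smul, inv_mul_cancel₀ hc]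
    simp
  have hCB := (Matrix.mul_eq_one_comm_of_card_eq _ _ _ (by simp)).1 hBC
  rw [Matrix.fromCols_mul_fromRows] at hCB
  have hGK : G * (K * R) = Matrix.vecMulVec (G *ᵥ u) (G *ᵥ u) := by
    rw [← Matrix.mul_assoc]
    ext i j
    simp [R, K, Matrix.mul_apply, Matrix.mulVec, dotProduct, Matrix.vecMulVec_apply]
  calc G = G * (c⁻¹ • (G⁻¹ * Aᵀ * H) * A + K * R) := by rw [hCB, Matrix.mul_one]
    _ = _ := by
      rw [Matrix.mul_add, hGK, Matrix.smul_mul, Matrix.mul_smul, Matrix.mul_assoc, Matrix.mul_assoc,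
        Matrix.mul_nonsing_inv_cancel_left _ _ hG, add_comm, Matrix.mul_assoc]

theorem isUnit_det_of_isMetric {n : ℕ} {g : (Fin n → ℝ) → Matrix (Fin n) (Fin n) ℝ}
    (hg : IsMetric g) (x : Fin n → ℝ) : IsUnit (g x).det :=
  (hg.2 x).2.det_pos.ne'.isUnit

/-- For a unit field, `L_U θ = (∇_U U)♭`. -/
theorem lieForm_flat {g : (Fin 3 → ℝ) → Matrix (Fin 3) (Fin 3) ℝ}
    {U : (Fin 3 → ℝ) → Fin 3 → ℝ} (hg : IsMetric g) (hU : SmoothVF U) (hunit : UnitField g U)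
    (i : Fin 3) (x : Fin 3 → ℝ) :
    lieForm (flat g U) U i x = ∑ k, g x i k * meanCurv g U x k := by
  have dg : ∀ a b, DifferentiableAt ℝ (fun y => g y a b) x := fun a b =>
    ((hg.1 a b).differentiable (by simp)).differentiableAt
  have dU : ∀ k, DifferentiableAt ℝ (fun y => U y k) x := fun k =>
    ((hU k).differentiable (by simp)).differentiableAt
  have hsymm : ∀ y a b, g y b a = g y a b := fun y a b => (hg.2 y).1.apply a b
  have hflat : ∀ k, pd (flat g U i) k x
      = ∑ l, (pd (fun y => g y i l) k x * U x l + g x i l * pd (fun y => U y l) k x) := fun k => by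
    unfold flat
    rw [pd_sum fun l _ => (dg i l).fun_mul (dU l)]
    exact Finset.sum_congr rfl fun l _ => pd_mul (dg i l) (dU l) k
  have hone : ∑ a, ∑ b, ((pd (fun y => g y a b) i x * U x a + g x a b * pd (fun y => U y a) i x)
      * U x b + g x a b * U x a * pd (fun y => U y b) i x) = 0 := by
    have h := pd_const (x := x) 1 i
    rw [← funext hunit, pd_sum fun a _ => DifferentiableAt.fun_sum fun b _ =>
      ((dg a b).fun_mul (dU a)).fun_mul (dU b)] at h
    rw [← h]
    refine Finset.sum_congr rfl fun a _ => ?_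
    rw [pd_sum fun b _ => ((dg a b).fun_mul (dU a)).fun_mul (dU b)]
    refine Finset.sum_congr rfl fun b _ => ?_
    rw [pd_mul ((dg a b).fun_mul (dU a)) (dU b), pd_mul (dg a b) (dU a)]
  have hchr : ∑ k, g x i k * meanCurv g U x k
      = (∑ k, g x i k * ∑ a, U x a * pd (fun y => U y k) a x)
        + ∑ a, ∑ b, (∑ k, g x i k * christoffel g k a b x) * (U x a * U x b) := by
    simp only [meanCurv, covD, mul_add, Finset.sum_add_distrib, Finset.sum_mul]
    congr 1
    simp only [Finset.mul_sum]
    rw [Finset.sum_comm]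
    refine Finset.sum_congr rfl fun a _ => ?_
    rw [Finset.sum_comm]
    refine Finset.sum_congr rfl fun b _ => Finset.sum_congr rfl fun k _ => ?_
    ring
  simp only [hchr, sum_mul_christoffel (isUnit_det_of_isMetric hg x), lieForm, hflat]
  simp only [flat, Fin.sum_univ_three] at hone ⊢
  simp only [hsymm _ 0 1, hsymm _ 0 2, hsymm _ 1 2] at hone ⊢
  linear_combination (1 / 2) * hone

open scoped Matrix in
/-- The metric splits as `g = θ² + λ⁻² φ^* h`. -/
theorem metric_eq_of_semiConformal {g : (Fin 3 → ℝ) → Matrix (Fin 3) (Fin 3) ℝ}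
    {h : (Fin 2 → ℝ) → Matrix (Fin 2) (Fin 2) ℝ}
    {φ : (Fin 3 → ℝ) → Fin 2 → ℝ} {lam : (Fin 3 → ℝ) → ℝ} {U : (Fin 3 → ℝ) → Fin 3 → ℝ}
    (hg : IsMetric g) (hh : IsMetric h) (hlampos : ∀ x, 0 < lam x)
    (hsc : SemiConformal g h φ lam) (hUvert : Vertical φ U) (hUunit : UnitField g U) :
    g = fun y => Matrix.vecMulVec (fun k => flat g U k y) (fun k => flat g U k y)
      + (lam y ^ 2)⁻¹ • ∑ α, ∑ β, h (φ y) α β •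
          Matrix.vecMulVec (fun k => pd (fun z => φ z α) k y)
            (fun k => pd (fun z => φ z β) k y) := by
  funext y
  set A : Matrix (Fin 2) (Fin 3) ℝ := Matrix.of fun α i => pd (fun z => φ z α) i y
  have hA : A * (g y)⁻¹ * Aᵀ = lam y ^ 2 • (h (φ y))⁻¹ := by
    ext α β
    refine Eq.trans ?_ (hsc y α β)
    simp only [Matrix.mul_apply, Matrix.transpose_apply, Finset.sum_mul, ginv, A, Matrix.of_apply]
    rw [Finset.sum_comm]
    refine Finset.sum_congr rfl fun i _ => Finset.sum_congr rfl fun j _ => ?_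
    ring
  have hu : U y ⬝ᵥ g y *ᵥ U y = 1 := by
    rw [← hUunit y]
    simp only [dotProduct, Matrix.mulVec, Finset.mul_sum]
    refine Finset.sum_congr rfl fun i _ => Finset.sum_congr rfl fun j _ => ?_
    ring
  have key := eq_vecMulVec_add_of_mul_inv_mul_transpose (hg.2 y).1 (isUnit_det_of_isMetric hg y)
    (isUnit_det_of_isMetric hh (φ y)) (pow_ne_zero 2 (hlampos y).ne') hA
    (funext fun α => hUvert y α) hu
  refine key.trans ?_
  congr 2
  ext i j
  simp only [Matrix.mul_apply, Matrix.transpose_apply, Matrix.sum_apply, Matrix.smul_apply,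
    Matrix.vecMulVec_apply, Finset.sum_mul, smul_eq_mul, A, Matrix.of_apply]
  rw [Finset.sum_comm]
  refine Finset.sum_congr rfl fun α _ => Finset.sum_congr rfl fun β _ => ?_
  ring

/-- A pulled-back tensor is invariant along vertical fields: `L_U (φ^* h) = 0`. -/
theorem lieD_pullback_eq_zero {h : (Fin 2 → ℝ) → Matrix (Fin 2) (Fin 2) ℝ}
    {φ : (Fin 3 → ℝ) → Fin 2 → ℝ} {U : (Fin 3 → ℝ) → Fin 3 → ℝ}
    (hh : ∀ α β, ContDiff ℝ (⊤ : ℕ∞) fun x => h x α β)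
    (hφ : ∀ α, ContDiff ℝ (⊤ : ℕ∞) fun x => φ x α)
    (hU : SmoothVF U) (hUvert : Vertical φ U) (i j : Fin 3) (x : Fin 3 → ℝ) :
    lieD (fun y => ∑ α, ∑ β, h (φ y) α β •
      Matrix.vecMulVec (fun k => pd (fun z => φ z α) k y) (fun k => pd (fun z => φ z β) k y))
      U i j x = 0 := by
  have dφ : ∀ α, DifferentiableAt ℝ (fun y => φ y α) x := fun α =>
    ((hφ α).differentiable (by simp)).differentiableAt
  have dA : ∀ α k, DifferentiableAt ℝ (pd (fun z => φ z α) k) x := fun α k =>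
    ((contDiff_pd (hφ α) k).differentiable (by simp)).differentiableAt
  have dh : ∀ α β, DifferentiableAt ℝ (fun z => h z α β) (φ x) := fun α β =>
    ((hh α β).differentiable (by simp)).differentiableAt
  have dhφ : ∀ α β, DifferentiableAt ℝ (fun y => h (φ y) α β) x := fun α β =>
    (dh α β).comp x (differentiableAt_pi.2 dφ)
  have dU : ∀ k, DifferentiableAt ℝ (fun y => U y k) x := fun k =>
    ((hU k).differentiable (by simp)).differentiableAt
  have dV : ∀ α β a b, DifferentiableAt ℝ (fun y => Matrix.vecMulVec
      (fun k => pd (fun z => φ z α) k y) (fun k => pd (fun z => φ z β) k y) a b) x :=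
    fun α β a b => (dA α a).mul (dA β b)
  have dT : ∀ α β a b, DifferentiableAt ℝ (fun y => (h (φ y) α β • Matrix.vecMulVec
      (fun k => pd (fun z => φ z α) k y) (fun k => pd (fun z => φ z β) k y)) a b) x :=
    fun α β a b => (dhφ α β).mul (dV α β a b)
  have hform : ∀ α k, lieForm (pd fun z => φ z α) U k x = 0 := fun α k => by
    rw [lieForm_pd (hφ α) dU, funext fun y => hUvert y α, pd_const]
  have hhφ : ∀ α β, ∑ k, U x k * pd (fun y => h (φ y) α β) k x = 0 := fun α β => by
    simp only [pd_comp (dh α β) dφ, Finset.mul_sum]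
    rw [Finset.sum_comm]
    refine Finset.sum_eq_zero fun γ _ => ?_
    rw [← zero_mul (pd (fun z => h z α β) γ (φ x)), ← hUvert x γ, Finset.sum_mul]
    exact Finset.sum_congr rfl fun k _ => by ring
  rw [lieD_sum fun α _ a b => by
    simpa only [Matrix.sum_apply] using DifferentiableAt.fun_sum fun β _ => dT α β a b]
  refine Finset.sum_eq_zero fun α _ => ?_
  rw [lieD_sum fun β _ => dT α β]
  refine Finset.sum_eq_zero fun β _ => ?_
  rw [lieD_smul (dhφ α β) (dV α β), hhφ, lieD_vecMulVec (dA α) (dA β), hform, hform]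
  ring

/-- `L_U g = −2 U(ln λ)(g − θ²) + 2 μ♭ ⊙ θ`. -/
theorem lieD_unit_vertical {g : (Fin 3 → ℝ) → Matrix (Fin 3) (Fin 3) ℝ}
    {h : (Fin 2 → ℝ) → Matrix (Fin 2) (Fin 2) ℝ}
    {φ : (Fin 3 → ℝ) → Fin 2 → ℝ} {lam : (Fin 3 → ℝ) → ℝ} {U : (Fin 3 → ℝ) → Fin 3 → ℝ}
    (hg : IsMetric g) (hh : IsMetric h)
    (hφ : ∀ α, ContDiff ℝ (⊤ : ℕ∞) fun x => φ x α)
    (hlam : ContDiff ℝ (⊤ : ℕ∞) lam) (hlampos : ∀ x, 0 < lam x)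
    (hsc : SemiConformal g h φ lam)
    (hU : SmoothVF U) (hUvert : Vertical φ U) (hUunit : UnitField g U)
    (i j : Fin 3) (x : Fin 3 → ℝ) :
    lieD g U i j x =
      -2 * (∑ k, U x k * pd (fun y => Real.log (lam y)) k x)
          * (g x i j - flat g U i x * flat g U j x)
        + ((∑ k, g x i k * meanCurv g U x k) * flat g U j x
          + (∑ k, g x j k * meanCurv g U x k) * flat g U i x) := by
  have dlam : DifferentiableAt ℝ lam x := (hlam.differentiable (by simp)).differentiableAt
  have dc : DifferentiableAt ℝ (fun y => (lam y ^ 2)⁻¹) x :=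
    (dlam.pow 2).inv (pow_ne_zero 2 (hlampos x).ne')
  have dθ : ∀ k, DifferentiableAt ℝ (flat g U k) x := fun k =>
    DifferentiableAt.fun_sum fun l _ =>
      (((hg.1 k l).differentiable (by simp)).differentiableAt).mul
        (((hU l).differentiable (by simp)).differentiableAt)
  have dθθ : ∀ a b, DifferentiableAt ℝ (fun y => Matrix.vecMulVec
      (fun k => flat g U k y) (fun k => flat g U k y) a b) x := fun a b => (dθ a).mul (dθ b)
  set Q : (Fin 3 → ℝ) → Matrix (Fin 3) (Fin 3) ℝ := fun y => ∑ α, ∑ β, h (φ y) α β •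
    Matrix.vecMulVec (fun k => pd (fun z => φ z α) k y)
      (fun k => pd (fun z => φ z β) k y) with hQ
  have dQ : ∀ a b, DifferentiableAt ℝ (fun y => Q y a b) x := fun a b => by
    simp only [hQ, Matrix.sum_apply, Matrix.smul_apply, Matrix.vecMulVec_apply]
    refine DifferentiableAt.fun_sum fun α _ => DifferentiableAt.fun_sum fun β _ => ?_
    refine DifferentiableAt.mul ?_ (DifferentiableAt.mul ?_ ?_)
    · exact (((hh.1 α β).comp (contDiff_pi.2 hφ)).differentiable (by simp)).differentiableAt
    · exact ((contDiff_pd (hφ α) a).differentiable (by simp)).differentiableAt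
    · exact ((contDiff_pd (hφ β) b).differentiable (by simp)).differentiableAt
  have dcQ : ∀ a b, DifferentiableAt ℝ (fun y => ((lam y ^ 2)⁻¹ • Q y) a b) x :=
    fun a b => dc.fun_mul (dQ a b)
  have hsplit := metric_eq_of_semiConformal hg hh hlampos hsc hUvert hUunit
  have hgx : g x i j = flat g U i x * flat g U j x + (lam x ^ 2)⁻¹ * Q x i j :=
    congrFun (congrFun (congrFun hsplit x) i) j
  have hlie : lieD g U i j x
      = lieD (fun y => Matrix.vecMulVec (fun k => flat g U k y) (fun k => flat g U k y)
        + (lam y ^ 2)⁻¹ • Q y) U i j x :=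
    congrArg (fun T => lieD T U i j x) hsplit
  rw [hlie, lieD_add dθθ dcQ, lieD_vecMulVec dθ dθ, lieD_smul dc dQ,
    lieD_pullback_eq_zero hh.1 hφ hU hUvert, lieForm_flat hg hU hUunit,
    lieForm_flat hg hU hUunit, hgx]
  have hpd : ∑ k, U x k * pd (fun y => (lam y ^ 2)⁻¹) k x
      = -2 * (∑ k, U x k * pd (fun y => Real.log (lam y)) k x) * (lam x ^ 2)⁻¹ := by
    simp only [pd_inv_sq dlam (hlampos x).ne', pd_log dlam (hlampos x).ne', Finset.mul_sum,
      Finset.sum_mul]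
    exact Finset.sum_congr rfl fun k _ => by ring
  rw [hpd]
  ring

/-- For a unit field `U` tangent to a conformal foliation given by the fibres
of a semi-conformal `φ` with dilation `λ`, and any smooth `f`,
`L_{fU} g = −2 f U(ln λ)(g − θ²) + 2 df ⊙ θ + 2 f μ♭ ⊙ θ`. -/
theorem lie_derivative_along_fU
    (g : (Fin 3 → ℝ) → Matrix (Fin 3) (Fin 3) ℝ)
    (h : (Fin 2 → ℝ) → Matrix (Fin 2) (Fin 2) ℝ)
    (φ : (Fin 3 → ℝ) → Fin 2 → ℝ) (lam : (Fin 3 → ℝ) → ℝ)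
    (U : (Fin 3 → ℝ) → Fin 3 → ℝ) (f : (Fin 3 → ℝ) → ℝ)
    (hg : IsMetric g) (hh : IsMetric h)
    (hφ : ∀ α, ContDiff ℝ (⊤ : ℕ∞) fun x => φ x α)
    (hlam : ContDiff ℝ (⊤ : ℕ∞) lam) (hlampos : ∀ x, 0 < lam x)
    (hsc : SemiConformal g h φ lam)
    (hU : SmoothVF U) (hUvert : Vertical φ U) (hUunit : UnitField g U)
    (hf : ContDiff ℝ (⊤ : ℕ∞) f) :
    ∀ x i j,
      lieD g (fun y k => f y * U y k) i j x =
        -2 * f x * (∑ k, U x k * pd (fun y => Real.log (lam y)) k x)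
            * (g x i j - flat g U i x * flat g U j x)
          + (pd f i x * flat g U j x + pd f j x * flat g U i x)
          + f x * ((∑ k, g x i k * meanCurv g U x k) * flat g U j x
              + (∑ k, g x j k * meanCurv g U x k) * flat g U i x) := by
  intro x i j
  have dU : ∀ k, DifferentiableAt ℝ (fun y => U y k) x := fun k =>
    ((hU k).differentiable (by simp)).differentiableAt
  have hflat : ∑ k, g x k j * U x k = flat g U j x :=
    Finset.sum_congr rfl fun k _ => by rw [(hg.2 x).1.apply j k]
  rw [lieD_smul_field (hf.differentiable (by simp)).differentiableAt dU, hflat,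
    lieD_unit_vertical hg hh hφ hlam hlampos hsc hU hUvert hUunit]
  change _ + pd f j x * flat g U i x = _
  ring
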